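/- Let V be a vector configuration with n elements and rank r in a finite-dimensional real vector space E with dim E ≥ 1, set δ = deg*(V) and d = n − r − 1, and suppose r ≤ 4. Then V admits a codegree* decomposition of length m for some natural number m with m ≥ d + 1 − 2δ (an inequality of integers). -/

import Mathlib

open scoped Classical

noncomputable section

variable {E : Type*} [AddCommGroup E] [Module ℝ E] {ι : Type*} [Fintype ι]

/-- Number of indices where the functional is positive. -/
def posCount (φ : E →ₗ[ℝ] ℝ) (V : ι → E) : ℕ :=
  (Finset.univ.filter fun i => 0 < φ (V i)).card

/-- Number of indices where the functional is negative. -/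
def negCount (φ : E →ₗ[ℝ] ℝ) (V : ι → E) : ℕ :=
  (Finset.univ.filter fun i => φ (V i) < 0).card

/-- Number of indices where the functional is nonpositive. -/
def nonposCount (φ : E →ₗ[ℝ] ℝ) (V : ι → E) : ℕ :=
  (Finset.univ.filter fun i => φ (V i) ≤ 0).card

/-- Dual codegree: minimum over nonzero functionals of `nonposCount`; by convention the
number of elements when the ambient space is zero-dimensional (trivial). -/
def codegStar (V : ι → E) : ℕ :=
  if Nontrivial E then
    sInf {k | ∃ φ : E →ₗ[ℝ] ℝ, φ ≠ 0 ∧ nonposCount φ V = k}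
  else Fintype.card ι

/-- Rank of a configuration: dimension of the linear span. -/
def confRank (V : ι → E) : ℕ :=
  Module.finrank ℝ (Submodule.span ℝ (Set.range V))

/-- Dual degree: maximum over nonzero functionals of `posCount`, minus the rank. -/
def degStar (V : ι → E) : ℤ :=
  (sSup {k | ∃ φ : E →ₗ[ℝ] ℝ, φ ≠ 0 ∧ posCount φ V = k} : ℕ) - (confRank V : ℤ)

/-- Covector discrepancy: maximum over all functionals of `|φ⁺(V) − φ⁻(V)|`. -/
def disc (V : ι → E) : ℕ :=
  sSup {k | ∃ φ : E →ₗ[ℝ] ℝ, k = ((posCount φ V : ℤ) - (negCount φ V : ℤ)).natAbs}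

/-- The subfamily of `V` indexed by `S`. -/
def subfam (V : ι → E) (S : Finset ι) : {i // i ∈ S} → E := fun i => V i.1

/-- The contraction `V/W`, where `W = V|S`: images of the remaining vectors in the
quotient by the span of `W`. -/
def contract (V : ι → E) (S : Finset ι) :
    {i // i ∉ S} → E ⧸ Submodule.span ℝ (V '' (S : Set ι)) :=
  fun i => Submodule.Quotient.mk (V i.1)

/-- `V|S` is linearly closed in `V`. -/
def LinClosed (V : ι → E) (S : Finset ι) : Prop :=
  ∀ i, V i ∈ Submodule.span ℝ (V '' (S : Set ι)) → i ∈ S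

/-- A codegree* decomposition of `V` of length `m`: a partition of the index set into
parts `S 0, S 1, …, S m` with `codegStar (V|S i) ≥ 1` for `i ≠ 0` and
`codegStar V = ∑_{i=1}^m codegStar (V|S i)`. -/
def IsCodegDecomp (V : ι → E) (m : ℕ) (S : Fin (m + 1) → Finset ι) : Prop :=
  (∀ i j, i ≠ j → Disjoint (S i) (S j)) ∧
  (∀ x, ∃ i, x ∈ S i) ∧
  (∀ i, i ≠ 0 → 1 ≤ codegStar (subfam V (S i))) ∧
  codegStar V = ∑ i ∈ Finset.univ.erase (0 : Fin (m + 1)), codegStar (subfam V (S i))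


set_option linter.unusedSectionVars false

/-! ## Signs, perturbation, restriction -/

/-- Integer-valued sign. -/
def sg (x : ℝ) : ℤ := if 0 < x then 1 else if x < 0 then -1 else 0

lemma sg_pos {x : ℝ} (h : 0 < x) : sg x = 1 := by simp [sg, h]
lemma sg_neg {x : ℝ} (h : x < 0) : sg x = -1 := by simp [sg, h, not_lt.2 h.le]
lemma sg_zero : sg 0 = 0 := by simp [sg]
lemma sg_neg_arg (x : ℝ) : sg (-x) = - sg x := by
  rcases lt_trichotomy x 0 with h | h | h
  · rw [sg_neg h, sg_pos (by linarith)]; norm_num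
  · subst h; simp [sg_zero]
  · rw [sg_pos h, sg_neg (by linarith)]

/-- The signed count of a functional on the subfamily indexed by `S`. -/
def ff (v : ι → E) (S : Finset ι) (φ : E →ₗ[ℝ] ℝ) : ℤ := ∑ i ∈ S, sg (φ (v i))

lemma ff_neg (v : ι → E) (S : Finset ι) (φ : E →ₗ[ℝ] ℝ) : ff v S (-φ) = - ff v S φ := by
  simp [ff, sg_neg_arg]

lemma perturb (v : ι → E) (φ ψ : E →ₗ[ℝ] ℝ) : ∃ χ : E →ₗ[ℝ] ℝ,
    (∀ i, φ (v i) ≠ 0 → sg (χ (v i)) = sg (φ (v i))) ∧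
    (∀ i, φ (v i) = 0 → sg (χ (v i)) = sg (ψ (v i))) ∧
    (∀ x, φ x = 0 → ψ x = 0 → χ x = 0) := by
  have h1 : ∀ i, ∀ᶠ ε : ℝ in nhdsWithin 0 (Set.Ioi 0),
      φ (v i) ≠ 0 → sg (φ (v i) + ε * ψ (v i)) = sg (φ (v i)) := by
    intro i
    have hc : Filter.Tendsto (fun ε : ℝ => φ (v i) + ε * ψ (v i)) (nhdsWithin 0 (Set.Ioi 0))
        (nhds (φ (v i))) := by
      have : Continuous (fun ε : ℝ => φ (v i) + ε * ψ (v i)) := by fun_prop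
      have h := this.tendsto 0
      simp only [zero_mul, add_zero] at h
      exact h.mono_left nhdsWithin_le_nhds
    rcases lt_trichotomy (φ (v i)) 0 with h | h | h
    · filter_upwards [hc.eventually (gt_mem_nhds h)] with ε hε _
      rw [sg_neg h, sg_neg hε]
    · exact Filter.Eventually.of_forall fun _ h' => absurd h h'
    · filter_upwards [hc.eventually (lt_mem_nhds h)] with ε hε _
      rw [sg_pos h, sg_pos hε]
  obtain ⟨ε, hε, hpos⟩ := ((Filter.eventually_all.2 h1).and self_mem_nhdsWithin).exists
  have hpos : 0 < ε := hpos
  refine ⟨φ + ε • ψ, fun i hi => by simpa using hε i hi, fun i hi => ?_, fun x h h' => by simp [h, h']⟩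
  simp only [LinearMap.add_apply, hi, LinearMap.smul_apply, smul_eq_mul, zero_add]
  rcases lt_trichotomy (ψ (v i)) 0 with h | h | h
  · rw [sg_neg h, sg_neg (mul_neg_of_pos_of_neg hpos h)]
  · simp [h]
  · rw [sg_pos h, sg_pos (mul_pos hpos h)]

lemma ff_of_perturb (v : ι → E) {φ ψ χ : E →ₗ[ℝ] ℝ}
    (h1 : ∀ i, φ (v i) ≠ 0 → sg (χ (v i)) = sg (φ (v i)))
    (h2 : ∀ i, φ (v i) = 0 → sg (χ (v i)) = sg (ψ (v i))) (S : Finset ι) :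
    ff v S χ = ff v S φ + ff v (S.filter fun i => φ (v i) = 0) ψ := by
  unfold ff
  rw [Finset.sum_filter, ← Finset.sum_add_distrib]
  refine Finset.sum_congr rfl fun i _ => ?_
  by_cases h : φ (v i) = 0
  · simp [h2 i h, h, sg_zero]
  · simp [h1 i h, h]

lemma exists_generic (v : ι → E) (F : Submodule ℝ E) : ∃ φ : E →ₗ[ℝ] ℝ,
    (∀ x ∈ F, φ x = 0) ∧ ∀ i, v i ∉ F → φ (v i) ≠ 0 := by
  have key : ∀ T : Finset ι, ∃ φ : E →ₗ[ℝ] ℝ,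
      (∀ x ∈ F, φ x = 0) ∧ ∀ i ∈ T, v i ∉ F → φ (v i) ≠ 0 := by
    intro T
    induction T using Finset.induction_on with
    | empty => exact ⟨0, by simp, by simp⟩
    | insert a T ha ih =>
      obtain ⟨φ, hφ, hT⟩ := ih
      by_cases h : v a ∉ F ∧ φ (v a) = 0
      · obtain ⟨ψ, hψ, hF⟩ := Submodule.exists_le_ker_of_notMem h.1
        obtain ⟨χ, c1, c2, c3⟩ := perturb v φ ψ
        refine ⟨χ, fun x hx => c3 x (hφ x hx) (hF hx), fun i hi hiF h0 => ?_⟩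
        rcases Finset.mem_insert.1 hi with rfl | hi
        · have := c2 i h.2
          rw [h0, sg_zero] at this
          unfold sg at this
          rcases lt_or_gt_of_ne hψ with h | h
          · simp [h, not_lt.2 h.le] at this
          · simp [h] at this
        · have := c1 i (hT i hi hiF)
          rw [h0, sg_zero] at this
          unfold sg at this
          rcases lt_or_gt_of_ne (hT i hi hiF) with h | h
          · simp [h, not_lt.2 h.le] at this
          · simp [h] at this
      · push Not at h
        refine ⟨φ, hφ, fun i hi hiF => ?_⟩
        rcases Finset.mem_insert.1 hi with rfl | hi
        · exact h hiF
        · exact hT i hi hiF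
  obtain ⟨φ, h1, h2⟩ := key Finset.univ
  exact ⟨φ, h1, fun i => h2 i (Finset.mem_univ i)⟩

/-- members of `S` in the subspace `F` -/
def inF (v : ι → E) (S : Finset ι) (F : Submodule ℝ E) : Finset ι := S.filter fun i => v i ∈ F

lemma mem_inF {v : ι → E} {S : Finset ι} {F : Submodule ℝ E} {i : ι} :
    i ∈ inF v S F ↔ i ∈ S ∧ v i ∈ F := by simp [inF]

lemma restrict_eq (v : ι → E) (F : Submodule ℝ E) : ∃ φ : E →ₗ[ℝ] ℝ, (∀ x ∈ F, φ x = 0) ∧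
    ∀ ψ : E →ₗ[ℝ] ℝ, ∃ χ : E →ₗ[ℝ] ℝ, (∀ x, φ x = 0 → ψ x = 0 → χ x = 0) ∧
      ∀ S, ff v S χ = ff v S φ + ff v (inF v S F) ψ := by
  obtain ⟨φ, h1, h2⟩ := exists_generic v F
  refine ⟨φ, h1, fun ψ => ?_⟩
  obtain ⟨χ, c1, c2, c3⟩ := perturb v φ ψ
  refine ⟨χ, c3, fun S => ?_⟩
  rw [ff_of_perturb v c1 c2 S]
  congr 2
  unfold inF
  refine Finset.filter_congr fun i _ => ⟨fun h => ?_, fun h => h1 _ h⟩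
  by_contra h'
  exact h2 i h' h

lemma ff_restrict_le (v : ι → E) (S : Finset ι) (F : Submodule ℝ E) (D : ℤ)
    (hD : ∀ φ, ff v S φ ≤ D) (ψ : E →ₗ[ℝ] ℝ) : ff v (inF v S F) ψ ≤ D := by
  obtain ⟨φ, -, h⟩ := restrict_eq v F
  obtain ⟨χ, -, hχ⟩ := h ψ
  obtain ⟨χ', -, hχ'⟩ := h (-ψ)
  have h1 := hχ S
  have h2 := hχ' S
  rw [ff_neg] at h2
  have h3 := hD χ
  have h4 := hD (-χ')
  rw [ff_neg] at h4
  linarith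

lemma ff_ker_le (v : ι → E) (S : Finset ι) (D : ℤ)
    (hD : ∀ φ, ff v S φ ≤ D) (φ ψ : E →ₗ[ℝ] ℝ) :
    ff v S φ + ff v (S.filter fun i => φ (v i) = 0) ψ ≤ D := by
  obtain ⟨χ, c1, c2, -⟩ := perturb v φ ψ
  rw [← ff_of_perturb v c1 c2 S]
  exact hD χ

/-- No zero vectors and no antipodal pairs. -/
def AF (v : ι → E) (S : Finset ι) : Prop :=
  ∀ i ∈ S, ∀ j ∈ S, ∀ c : ℝ, v j = c • v i → 0 < c

lemma AF.ne_zero {v : ι → E} {S : Finset ι} (h : AF v S) {i : ι} (hi : i ∈ S) : v i ≠ 0 := by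
  intro h0
  exact lt_irrefl _ (h i hi i hi 0 (by simp [h0]))

lemma AF.mono {v : ι → E} {S T : Finset ι} (h : AF v S) (hT : T ⊆ S) : AF v T :=
  fun i hi j hj => h i (hT hi) j (hT hj)

/-- in an `AF` family the members on a line through `v p` count positively -/
lemma ff_line (v : ι → E) (S : Finset ι) (h : AF v S) {p : ι} (hp : p ∈ S)
    (η : E →ₗ[ℝ] ℝ) (hη : 0 < η (v p)) :
    ff v (inF v S (Submodule.span ℝ {v p})) η = (inF v S (Submodule.span ℝ {v p})).card := by
  unfold ff
  rw [Finset.card_eq_sum_ones]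
  push_cast
  refine Finset.sum_congr rfl fun i hi => ?_
  obtain ⟨hi, hm⟩ := mem_inF.1 hi
  obtain ⟨c, hc⟩ := Submodule.mem_span_singleton.1 hm
  have := h p hp i hi c hc.symm
  rw [← hc]
  apply sg_pos
  simp only [map_smul, smul_eq_mul]
  positivity

lemma exists_pos_functional {x : E} (hx : x ≠ 0) : ∃ η : E →ₗ[ℝ] ℝ, 0 < η x := by
  obtain ⟨ψ, hψ, -⟩ := Submodule.exists_le_ker_of_notMem (p := (⊥ : Submodule ℝ E)) (v := x) (by simpa using hx)
  rcases lt_or_gt_of_ne hψ with h | h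
  · exact ⟨-ψ, by simpa using h⟩
  · exact ⟨ψ, h⟩

/-- bounded signed count bounds the multiplicity of each line -/
lemma line_card_le (v : ι → E) (S : Finset ι) (h : AF v S) (D : ℤ) (hD : ∀ φ, ff v S φ ≤ D)
    {p : ι} (hp : p ∈ S) : ((inF v S (Submodule.span ℝ {v p})).card : ℤ) ≤ D := by
  obtain ⟨η, hη⟩ := exists_pos_functional (h.ne_zero hp)
  rw [← ff_line v S h hp η hη]
  exact ff_restrict_le v S _ D hD η

/-- stronger: if `φ` vanishes at `v p`, then its count plus the multiplicity of `p` is at most `D` -/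
lemma ff_add_line_card_le (v : ι → E) (S : Finset ι) (h : AF v S) (D : ℤ) (hD : ∀ φ, ff v S φ ≤ D)
    {p : ι} (hp : p ∈ S) (φ : E →ₗ[ℝ] ℝ) (hφ : φ (v p) = 0) :
    ff v S φ + (inF v S (Submodule.span ℝ {v p})).card ≤ D := by
  have h1 := line_card_le v (S.filter fun i => φ (v i) = 0) (h.mono (Finset.filter_subset _ _))
    (D - ff v S φ) (fun ψ => by have := ff_ker_le v S D hD φ ψ; linarith) (p := p) (by simp [hp, hφ])
  have h2 : inF v (S.filter fun i => φ (v i) = 0) (Submodule.span ℝ {v p})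
      = inF v S (Submodule.span ℝ {v p}) := by
    ext i
    simp only [mem_inF, Finset.mem_filter]
    constructor
    · rintro ⟨⟨a, b⟩, c⟩; exact ⟨a, c⟩
    · rintro ⟨a, c⟩
      obtain ⟨k, hk⟩ := Submodule.mem_span_singleton.1 c
      exact ⟨⟨a, by rw [← hk]; simp [hφ]⟩, c⟩
  rw [h2] at h1
  linarith

lemma self_mem_line (v : ι → E) {S : Finset ι} {p : ι} (hp : p ∈ S) :
    p ∈ inF v S (Submodule.span ℝ {v p}) :=
  mem_inF.2 ⟨hp, Submodule.mem_span_singleton_self _⟩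

lemma line_card_pos (v : ι → E) {S : Finset ι} {p : ι} (hp : p ∈ S) :
    (1 : ℤ) ≤ (inF v S (Submodule.span ℝ {v p})).card := by
  exact_mod_cast Finset.card_pos.2 ⟨p, self_mem_line v hp⟩

/-! ## The key lemma on alternating lines -/

/-- The line through `v p` and `v y` is balanced at `v p`. -/
def Bal (v : ι → E) (S : Finset ι) (p y : ι) : Prop :=
  ∀ φ : E →ₗ[ℝ] ℝ, φ (v p) = 0 → ff v (inF v S (Submodule.span ℝ {v p, v y})) φ = 0

lemma end_lemma (v : ι → E) (S : Finset ι) (hA : AF v S) (hD : ∀ φ, ff v S φ ≤ 2)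
    {p z : ι} (hp : p ∈ S) (hz : z ∈ S) (hB : Bal v S p z) (a ψ : E →ₗ[ℝ] ℝ)
    (hψp : ψ (v p) = 0) (hψz : ψ (v z) ≠ 0) (hap : 0 < a (v p))
    (hmin : ∀ y ∈ inF v S (Submodule.span ℝ {v p, v z}), ψ (v y) ≠ 0 →
      a (v z) / ψ (v z) ≤ a (v y) / ψ (v y)) : 0 < ψ (v z) := by
  by_contra hneg
  have hneg : ψ (v z) < 0 := lt_of_le_of_ne (not_lt.1 hneg) hψz
  set F := inF v S (Submodule.span ℝ {v p, v z}) with hF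
  set θ : E →ₗ[ℝ] ℝ := a - (a (v z) / ψ (v z)) • ψ with hθ
  have hθz : θ (v z) = 0 := by
    simp only [hθ, LinearMap.sub_apply, LinearMap.smul_apply, smul_eq_mul]
    field_simp
    ring
  have hθp : θ (v p) = a (v p) := by simp [hθ, hψp]
  have hb := ff_ker_le v F 2 (ff_restrict_le v S _ 2 hD) θ (-ψ)
  have h0 : ff v F ψ = 0 := hB ψ hψp
  unfold ff at hb h0
  rw [Finset.sum_filter, ← Finset.sum_add_distrib] at hb
  have hb2 : ∑ i ∈ F, (sg (θ (v i)) + (if θ (v i) = 0 then sg ((-ψ) (v i)) else 0) - sg (ψ (v i)))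
      ≤ 2 := by
    rw [Finset.sum_sub_distrib, h0]; linarith
  have hpF : p ∈ F := mem_inF.2 ⟨hp, Submodule.subset_span (by simp)⟩
  have hzF : z ∈ F := mem_inF.2 ⟨hz, Submodule.subset_span (by simp)⟩
  have hpz : p ≠ z := by rintro rfl; exact hψz hψp
  have hval : ∀ i ∈ F, 0 ≤ sg (θ (v i)) + (if θ (v i) = 0 then sg ((-ψ) (v i)) else 0)
      - sg (ψ (v i)) := by
    intro i hi
    obtain ⟨hiS, hm⟩ := mem_inF.1 hi
    obtain ⟨d, c, hdc⟩ := Submodule.mem_span_pair.1 hm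
    by_cases hψi : ψ (v i) = 0
    · have hc : c = 0 := by
        rw [← hdc] at hψi
        simp only [map_add, map_smul, hψp, smul_eq_mul, mul_zero, zero_add] at hψi
        exact (mul_eq_zero.1 hψi).resolve_right hψz
      subst hc
      have hd : 0 < d := hA p hp i hiS d (by rw [← hdc]; simp)
      have : 0 < θ (v i) := by
        rw [← hdc]; simp only [zero_smul, add_zero, map_smul, hθp, smul_eq_mul]; positivity
      rw [hψi, sg_pos this, if_neg this.ne', sg_zero]; norm_num
    · by_cases hθi : θ (v i) = 0
      · have hd : d = 0 := by
          rw [← hdc] at hθi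
          simp only [map_add, map_smul, hθz, hθp, smul_eq_mul, mul_zero, add_zero] at hθi
          exact (mul_eq_zero.1 hθi).resolve_right hap.ne'
        subst hd
        have hc : 0 < c := hA z hz i hiS c (by rw [← hdc]; simp)
        have : ψ (v i) < 0 := by
          rw [← hdc]; simp only [zero_smul, zero_add, map_smul, smul_eq_mul]; nlinarith
        rw [hθi, if_pos rfl, sg_zero, LinearMap.neg_apply, sg_neg_arg, sg_neg this]; norm_num
      · have h1 := hmin i hi hψi
        have h2 : θ (v i) = ψ (v i) * (a (v i) / ψ (v i) - a (v z) / ψ (v z)) := by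
          simp only [hθ, LinearMap.sub_apply, LinearMap.smul_apply, smul_eq_mul]
          field_simp
        have h3 : 0 < a (v i) / ψ (v i) - a (v z) / ψ (v z) := by
          rcases h1.lt_or_eq with h | h
          · linarith
          · rw [h2, h] at hθi; simp at hθi
        rw [if_neg hθi]
        rcases lt_or_gt_of_ne hψi with h | h
        · rw [sg_neg h, h2, sg_neg (mul_neg_of_neg_of_pos h h3)]; norm_num
        · rw [sg_pos h, h2, sg_pos (mul_pos h h3)]; norm_num
  have h3 : ∑ i ∈ ({p, z} : Finset ι), (sg (θ (v i)) + (if θ (v i) = 0 then sg ((-ψ) (v i)) else 0)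
      - sg (ψ (v i))) ≤ 2 := by
    refine le_trans (Finset.sum_le_sum_of_subset_of_nonneg ?_ fun i hi _ => hval i hi) hb2
    intro i hi
    rcases Finset.mem_insert.1 hi with rfl | hi
    · exact hpF
    · rw [Finset.mem_singleton.1 hi]; exact hzF
  rw [Finset.sum_pair hpz, hθp, hψp, hθz, sg_pos hap, sg_zero, if_neg hap.ne', if_pos rfl,
    LinearMap.neg_apply, sg_neg_arg, sg_neg hneg] at h3
  norm_num at h3

/-- Key lemma: it is impossible that all lines through `p` and through `q` in a plane (other
than the line `pq` itself) are balanced at `p` and at `q`, respectively. -/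
lemma key_lemma (v : ι → E) (S : Finset ι) (hA : AF v S) (hD : ∀ φ, ff v S φ ≤ 2)
    {p q x : ι} (hp : p ∈ S) (hq : q ∈ S) (hx : x ∈ S) (hli : LinearIndependent ℝ ![v p, v q, v x])
    (hB : ∀ y ∈ S, v y ∈ Submodule.span ℝ {v p, v q, v x} → v y ∉ Submodule.span ℝ {v p, v q} →
      Bal v S p y ∧ Bal v S q y) : False := by
  have hfun : ∀ w : Fin 3 → ℝ, ∃ φ : E →ₗ[ℝ] ℝ, φ (v p) = w 0 ∧ φ (v q) = w 1 ∧ φ (v x) = w 2 := by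
    intro w
    obtain ⟨φ, hφ⟩ := LinearMap.exists_extend
      ((Finsupp.linearCombination ℝ w) ∘ₗ (hli.repr : _ →ₗ[ℝ] _))
    have : ∀ i, φ (![v p, v q, v x] i) = w i := by
      intro i
      have h := LinearMap.congr_fun hφ ⟨![v p, v q, v x] i, Submodule.subset_span ⟨i, rfl⟩⟩
      simp only [LinearMap.comp_apply, Submodule.subtype_apply] at h
      rw [h, hli.repr_eq_single i _ rfl]
      simp
    exact ⟨φ, this 0, this 1, this 2⟩
  obtain ⟨a, ap, aq, ax⟩ := hfun ![1, 0, 0]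
  obtain ⟨b, bp, bq, bx⟩ := hfun ![0, 1, 0]
  obtain ⟨ψ, pp, pq, px⟩ := hfun ![0, 0, 1]
  simp at ap aq ax bp bq bx pp pq px
  set Z := (inF v S (Submodule.span ℝ {v p, v q, v x})).filter fun i => ψ (v i) ≠ 0 with hZ
  have hxZ : x ∈ Z := by
    simp only [hZ, Finset.mem_filter, mem_inF]
    exact ⟨⟨hx, Submodule.subset_span (by simp)⟩, by rw [px]; norm_num⟩
  obtain ⟨z₀, hz₀, hz₀m⟩ := Finset.exists_min_image Z (fun i => a (v i) / ψ (v i)) ⟨x, hxZ⟩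
  obtain ⟨z, hz, hzm⟩ := Finset.exists_max_image
    (Z.filter fun i => a (v i) / ψ (v i) = a (v z₀) / ψ (v z₀)) (fun i => b (v i) / ψ (v i))
    ⟨z₀, by simp [hz₀]⟩
  simp only [Finset.mem_filter] at hz hzm
  obtain ⟨hzZ, hza⟩ := hz
  have hzZ' := hzZ
  simp only [hZ, Finset.mem_filter, mem_inF] at hzZ'
  obtain ⟨⟨hzS, hzW⟩, hψz⟩ := hzZ'
  have hpq : ∀ y ∈ Submodule.span ℝ {v p, v q}, ψ y = 0 := by
    intro y hy
    obtain ⟨c, d, rfl⟩ := Submodule.mem_span_pair.1 hy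
    simp [pp, pq]
  obtain ⟨hBp, hBq⟩ := hB z hzS hzW fun h => hψz (hpq _ h)
  have hsub : ∀ u ∈ ({v p, v q} : Set E), Submodule.span ℝ {u, v z} ≤
      Submodule.span ℝ {v p, v q, v x} := by
    intro u hu
    rw [Submodule.span_le]
    intro w hw
    rcases hw with rfl | hw
    · refine Submodule.subset_span ?_
      rcases hu with rfl | hu
      · simp
      · rw [Set.mem_singleton_iff.1 hu]; simp
    · rw [Set.mem_singleton_iff.1 hw]; exact hzW
  have h1 : 0 < ψ (v z) := by
    refine end_lemma v S hA hD hp hzS hBp a ψ pp hψz (by rw [ap]; norm_num) ?_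
    intro y hy hψy
    obtain ⟨hyS, hyF⟩ := mem_inF.1 hy
    rw [hza]
    exact hz₀m y (by simp only [hZ, Finset.mem_filter, mem_inF]; exact ⟨⟨hyS, hsub _ (by simp) hyF⟩, hψy⟩)
  have h2 : 0 < (-ψ) (v z) := by
    refine end_lemma v S hA hD hq hzS hBq b (-ψ) (by simp [pq]) (by simpa using hψz)
      (by rw [bq]; norm_num) ?_
    intro y hy hψy
    obtain ⟨hyS, hyF⟩ := mem_inF.1 hy
    have hψy : ψ (v y) ≠ 0 := by simpa using hψy
    simp only [LinearMap.neg_apply, div_neg, neg_le_neg_iff]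
    refine hzm y ⟨by simp only [hZ, Finset.mem_filter, mem_inF]; exact ⟨⟨hyS, hsub _ (by simp) hyF⟩, hψy⟩, ?_⟩
    rw [← hza]
    obtain ⟨d, c, hdc⟩ := Submodule.mem_span_pair.1 hyF
    have e1 : a (v y) = c * a (v z) := by rw [← hdc]; simp [aq]
    have e2 : ψ (v y) = c * ψ (v z) := by rw [← hdc]; simp [pq]
    have hc : c ≠ 0 := by rintro rfl; simp [e2] at hψy
    rw [e1, e2, mul_div_mul_left _ _ hc]
  simp only [LinearMap.neg_apply] at h2
  linarith

/-! ## Consequences -/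

lemma li3 {a b c : E} (ha : a ≠ 0) (hb : b ∉ Submodule.span ℝ {a})
    (hc : c ∉ Submodule.span ℝ {a, b}) : LinearIndependent ℝ ![a, b, c] := by
  rw [Fintype.linearIndependent_iff]
  intro g hg
  simp only [Fin.sum_univ_three, Matrix.cons_val_zero, Matrix.cons_val_one, Matrix.cons_val] at hg
  have h2 : g 2 = 0 := by
    by_contra h
    apply hc
    rw [Submodule.mem_span_pair]
    refine ⟨-(g 0 / g 2), -(g 1 / g 2), ?_⟩
    have : c = (g 2)⁻¹ • (g 2 • c) := by rw [smul_smul, inv_mul_cancel₀ h, one_smul]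
    have h' : g 2 • c = -(g 0 • a) - g 1 • b := by
      rw [← sub_eq_zero, ← hg]; abel
    rw [this, h']
    module
  have h1 : g 1 = 0 := by
    by_contra h
    apply hb
    rw [Submodule.mem_span_singleton]
    refine ⟨-(g 0 / g 1), ?_⟩
    have : b = (g 1)⁻¹ • (g 1 • b) := by rw [smul_smul, inv_mul_cancel₀ h, one_smul]
    have h' : g 1 • b = -(g 0 • a) := by
      rw [← sub_eq_zero, ← hg, h2]; simp [add_comm]
    rw [this, h']
    module
  have h0 : g 0 = 0 := by
    rw [h1, h2] at hg
    simpa [ha] using hg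
  intro i
  fin_cases i <;> assumption

lemma exists_three (v : ι → E) (S : Finset ι) [FiniteDimensional ℝ E]
    (h : 3 ≤ Module.finrank ℝ (Submodule.span ℝ (v '' (S : Set ι)))) :
    ∃ p ∈ S, ∃ q ∈ S, ∃ x ∈ S, LinearIndependent ℝ ![v p, v q, v x] := by
  by_contra hcon
  push Not at hcon
  have hle : ∀ G : Submodule ℝ E, Module.finrank ℝ G ≤ 2 → ∃ i ∈ S, v i ∉ G := by
    intro G hG
    by_contra hall
    push Not at hall
    have : Submodule.span ℝ (v '' (S : Set ι)) ≤ G := by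
      rw [Submodule.span_le]
      rintro _ ⟨i, hi, rfl⟩
      exact hall i hi
    have := Submodule.finrank_mono this
    omega
  obtain ⟨p, hp, h1⟩ := hle ⊥ (by simp)
  obtain ⟨q, hq, h2⟩ := hle (Submodule.span ℝ {v p}) ((finrank_span_le_card _).trans (by simp))
  obtain ⟨x, hx, h3⟩ := hle (Submodule.span ℝ {v p, v q}) (by
    have := finrank_span_finset_le_card (R := ℝ) ({v p, v q} : Finset E)
    simp only [Finset.coe_insert, Finset.coe_singleton] at this
    exact this.trans Finset.card_le_two)
  exact hcon p hp q hq x hx (li3 (by simpa using h1) h2 h3)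

/-- `Bal` from a bound: multiplicity of `p` equals the bound -/
lemma bal_of_card (v : ι → E) (S : Finset ι) (hA : AF v S) (D : ℤ) (hD : ∀ φ, ff v S φ ≤ D)
    {p : ι} (hp : p ∈ S) (hc : D ≤ (inF v S (Submodule.span ℝ {v p})).card) (y : ι) :
    Bal v S p y := by
  intro φ hφ
  set F := Submodule.span ℝ {v p, v y}
  have hpF : p ∈ inF v S F := mem_inF.2 ⟨hp, Submodule.subset_span (by simp)⟩
  have hle : Submodule.span ℝ {v p} ≤ F := Submodule.span_mono (by simp)
  have heq : inF v (inF v S F) (Submodule.span ℝ {v p}) = inF v S (Submodule.span ℝ {v p}) := by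
    ext i
    simp only [mem_inF]
    exact ⟨fun h => ⟨h.1.1, h.2⟩, fun h => ⟨⟨h.1, hle h.2⟩, h.2⟩⟩
  have hA' : AF v (inF v S F) := hA.mono (Finset.filter_subset _ _)
  have h1 := ff_add_line_card_le v _ hA' D (ff_restrict_le v S F D hD) hpF φ hφ
  have h2 := ff_add_line_card_le v _ hA' D (ff_restrict_le v S F D hD) hpF (-φ) (by simp [hφ])
  rw [heq] at h1 h2
  rw [ff_neg] at h2
  linarith

lemma sylvester_gallai (v : ι → E) (S : Finset ι) [FiniteDimensional ℝ E] (hA : AF v S)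
    (hD : ∀ φ, ff v S φ ≤ 1) :
    Module.finrank ℝ (Submodule.span ℝ (v '' (S : Set ι))) ≤ 2 := by
  by_contra hcon
  obtain ⟨p, hp, q, hq, x, hx, hli⟩ := exists_three v S (by omega)
  refine key_lemma v S hA (fun φ => (hD φ).trans (by norm_num)) hp hq hx hli ?_
  intro y _ _ _
  exact ⟨bal_of_card v S hA 1 hD hp (line_card_pos v hp) y,
    bal_of_card v S hA 1 hD hq (line_card_pos v hq) y⟩

lemma not_AF (v : ι → E) (S : Finset ι) (h : ¬ AF v S) :
    (∃ i ∈ S, v i = 0) ∨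
    ∃ i ∈ S, ∃ j ∈ S, i ≠ j ∧ v i ≠ 0 ∧ ∃ c : ℝ, c < 0 ∧ v j = c • v i := by
  unfold AF at h
  push Not at h
  obtain ⟨i, hi, j, hj, c, hc, hc0⟩ := h
  by_cases h0 : v j = 0
  · exact Or.inl ⟨j, hj, h0⟩
  right
  have hvi : v i ≠ 0 := by rintro h; rw [h] at hc; simp at hc; exact h0 hc
  have hc1 : c ≠ 0 := by rintro rfl; simp at hc; exact h0 hc
  have hc2 : c < 0 := lt_of_le_of_ne hc0 hc1
  refine ⟨i, hi, j, hj, ?_, hvi, c, hc2, hc⟩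
  rintro rfl
  have : (c - 1) • v i = 0 := by rw [sub_smul, ← hc]; simp
  rcases smul_eq_zero.1 this with h | h
  · linarith
  · exact hvi h

lemma cancel (v : ι → E) (S : Finset ι) :
    ∃ R ⊆ S, AF v R ∧ ∀ φ, ff v R φ = ff v S φ := by
  induction S using Finset.strongInduction with
  | H S ih =>
    by_cases hA : AF v S
    · exact ⟨S, subset_rfl, hA, fun _ => rfl⟩
    rcases not_AF v S hA with ⟨i, hi, h0⟩ | ⟨i, hi, j, hj, hij, -, c, hc, hcj⟩
    · obtain ⟨R, hR, hRA, hRf⟩ := ih (S.erase i) (Finset.erase_ssubset hi)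
      refine ⟨R, hR.trans (Finset.erase_subset _ _), hRA, fun φ => ?_⟩
      rw [hRf]
      unfold ff
      rw [← Finset.add_sum_erase S _ hi, h0]
      simp [sg_zero]
    · obtain ⟨R, hR, hRA, hRf⟩ := ih ((S.erase i).erase j)
        ((Finset.erase_subset _ _).trans_ssubset (Finset.erase_ssubset hi))
      refine ⟨R, hR.trans ((Finset.erase_subset _ _).trans (Finset.erase_subset _ _)), hRA,
        fun φ => ?_⟩
      rw [hRf]
      unfold ff
      rw [← Finset.add_sum_erase S _ hi,
        ← Finset.add_sum_erase (S.erase i) _ (Finset.mem_erase.2 ⟨hij.symm, hj⟩), hcj]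
      have : sg (φ (c • v i)) = - sg (φ (v i)) := by
        simp only [map_smul, smul_eq_mul]
        rcases lt_trichotomy (φ (v i)) 0 with h | h | h
        · rw [sg_neg h, sg_pos (mul_pos_of_neg_of_neg hc h)]; norm_num
        · simp [h, sg_zero]
        · rw [sg_pos h, sg_neg (mul_neg_of_neg_of_pos hc h)]
      rw [this]
      ring

/-- For a simple point, all unbalanced lines lie in a hyperplane of dimension at most three. -/
lemma exists_H (v : ι → E) (S : Finset ι) [FiniteDimensional ℝ E] (hA : AF v S)
    (hD : ∀ φ, ff v S φ ≤ 2) {p : ι} (hp : p ∈ S) :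
    ∃ H : Submodule ℝ E, v p ∈ H ∧ Module.finrank ℝ H ≤ 3 ∧
      ∀ y ∈ S, v y ∉ H → Bal v S p y := by
  set K := Submodule.span ℝ {v p} with hK
  set v' : ι → E ⧸ K := fun i => K.mkQ (v i) with hv'
  obtain ⟨R, hRS, hRA, hRf⟩ := cancel v' S
  have hff : ∀ (T : Finset ι) (φ' : (E ⧸ K) →ₗ[ℝ] ℝ), ff v' T φ' = ff v T (φ' ∘ₗ K.mkQ) :=
    fun T φ' => rfl
  have hlift : ∀ φ : E →ₗ[ℝ] ℝ, φ (v p) = 0 → ff v R φ = ff v S φ := by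
    intro φ hφ
    have hk : K ≤ LinearMap.ker φ := by
      rw [hK, Submodule.span_singleton_le_iff_mem]; exact hφ
    have := hRf (K.liftQ φ hk)
    rw [hff, hff, Submodule.liftQ_mkQ] at this
    exact this
  have hb : ∀ φ', ff v' R φ' ≤ 1 := by
    intro φ'
    rw [hRf, hff]
    have h1 : (φ' ∘ₗ K.mkQ) (v p) = 0 := by
      have : K.mkQ (v p) = 0 := by
        rw [Submodule.mkQ_apply, Submodule.Quotient.mk_eq_zero]
        exact Submodule.mem_span_singleton_self _
      simp [LinearMap.comp_apply, this]
    have h2 := ff_add_line_card_le v S hA 2 hD hp _ h1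
    have h3 := line_card_pos v hp
    linarith
  have hrank := sylvester_gallai v' R hRA hb
  set G := Submodule.span ℝ (v' '' (R : Set ι)) with hG
  refine ⟨G.comap K.mkQ, ?_, ?_, ?_⟩
  · rw [Submodule.mem_comap]
    have : K.mkQ (v p) = 0 := by
      rw [Submodule.mkQ_apply, Submodule.Quotient.mk_eq_zero]
      exact Submodule.mem_span_singleton_self _
    rw [this]; exact zero_mem _
  · -- dimension count
    set H := G.comap K.mkQ with hH
    have h1 := LinearMap.finrank_range_add_finrank_ker (K.mkQ ∘ₗ H.subtype)
    have h2 : Module.finrank ℝ (LinearMap.range (K.mkQ ∘ₗ H.subtype)) ≤ 2 := by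
      refine le_trans (Submodule.finrank_mono ?_) hrank
      rintro _ ⟨x, rfl⟩
      exact x.2
    have h3 : Module.finrank ℝ (LinearMap.ker (K.mkQ ∘ₗ H.subtype)) ≤ 1 := by
      have hKr : Module.finrank ℝ K ≤ 1 := (finrank_span_le_card _).trans (by simp)
      refine le_trans ?_ hKr
      have hm : ∀ x : LinearMap.ker (K.mkQ ∘ₗ H.subtype), (H.subtype ∘ₗ Submodule.subtype _) x ∈ K := by
        intro x
        have := x.2
        rw [LinearMap.mem_ker, LinearMap.comp_apply, Submodule.mkQ_apply,
          Submodule.Quotient.mk_eq_zero] at this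
        exact this
      refine LinearMap.finrank_le_finrank_of_injective
        (f := LinearMap.codRestrict K (H.subtype ∘ₗ Submodule.subtype _) hm) ?_
      intro x y hxy
      have := congrArg Subtype.val hxy
      exact Subtype.ext (Subtype.ext this)
    omega
  · intro y hy hyH φ hφ
    obtain ⟨φ₀, hφ₀, hχ⟩ := restrict_eq v (Submodule.span ℝ {v p, v y})
    obtain ⟨χ, hχ0, hχf⟩ := hχ φ
    have hφ₀p : φ₀ (v p) = 0 := hφ₀ _ (Submodule.subset_span (by simp))
    have e1 := hχf S
    have e2 := hχf R
    rw [hlift χ (hχ0 _ hφ₀p hφ), hlift φ₀ hφ₀p] at e2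
    have hempty : inF v R (Submodule.span ℝ {v p, v y}) = ∅ := by
      rw [Finset.eq_empty_iff_forall_notMem]
      intro i hi
      obtain ⟨hiR, hiF⟩ := mem_inF.1 hi
      obtain ⟨d, c, hdc⟩ := Submodule.mem_span_pair.1 hiF
      have hvp : K.mkQ (v p) = 0 := by
        rw [Submodule.mkQ_apply, Submodule.Quotient.mk_eq_zero]
        exact Submodule.mem_span_singleton_self _
      have hvi : v' i = c • K.mkQ (v y) := by
        simp only [hv', ← hdc, map_add, map_smul, hvp, smul_zero, zero_add]
      have hc : c ≠ 0 := by
        rintro rfl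
        exact hRA.ne_zero hiR (by rw [hvi, zero_smul])
      apply hyH
      rw [Submodule.mem_comap]
      have : K.mkQ (v y) = c⁻¹ • v' i := by rw [hvi, smul_smul, inv_mul_cancel₀ hc, one_smul]
      rw [this]
      exact G.smul_mem _ (Submodule.subset_span ⟨i, hiR, rfl⟩)
    rw [hempty] at e2
    have : ff v ∅ φ = 0 := by simp [ff]
    rw [this] at e2
    linarith

/-! ## Parity and the structure in rank four -/

lemma ff_parity (v : ι → E) (T : Finset ι) (φ : E →ₗ[ℝ] ℝ) :
    Even (ff v T φ - (T.filter fun i => φ (v i) ≠ 0).card) := by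
  unfold ff
  rw [Finset.card_filter]
  push_cast
  rw [← Finset.sum_sub_distrib]
  refine Finset.even_sum _ fun i _ => ?_
  rcases lt_trichotomy (φ (v i)) 0 with h | h | h
  · rw [sg_neg h]; simp [h.ne]
  · simp [h, sg_zero]
  · rw [sg_pos h]; simp [h.ne']

/-- The number of members of `S` on the line through `p` and `y`. -/
def NN (v : ι → E) (S : Finset ι) (p y : ι) : ℕ := (inF v S (Submodule.span ℝ {v p, v y})).card

lemma NN_comm (v : ι → E) (S : Finset ι) (p y : ι) : NN v S p y = NN v S y p := by
  unfold NN; rw [Set.pair_comm]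

lemma line_parity (v : ι → E) (S : Finset ι) (p y : ι) (φ : E →ₗ[ℝ] ℝ)
    (hp : φ (v p) = 0) (hy : φ (v y) ≠ 0) :
    Even (ff v (inF v S (Submodule.span ℝ {v p, v y})) φ - NN v S p y
      + (inF v S (Submodule.span ℝ {v p})).card) := by
  have h := ff_parity v (inF v S (Submodule.span ℝ {v p, v y})) φ
  have h2 := Finset.card_filter_add_card_filter_not (s := inF v S (Submodule.span ℝ {v p, v y}))
    (fun i => φ (v i) = 0)
  have h3 : (inF v S (Submodule.span ℝ {v p, v y})).filter (fun i => φ (v i) = 0)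
      = inF v S (Submodule.span ℝ {v p}) := by
    ext i
    simp only [Finset.mem_filter, mem_inF]
    constructor
    · rintro ⟨⟨a, b⟩, c⟩
      refine ⟨a, ?_⟩
      obtain ⟨d, e, hde⟩ := Submodule.mem_span_pair.1 b
      rw [← hde] at c ⊢
      simp only [map_add, map_smul, hp, smul_eq_mul, mul_zero, zero_add] at c
      rw [(mul_eq_zero.1 c).resolve_right hy]
      simpa using Submodule.smul_mem _ _ (Submodule.mem_span_singleton_self _)
    · rintro ⟨a, b⟩
      refine ⟨⟨a, Submodule.span_mono (by simp) b⟩, ?_⟩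
      obtain ⟨d, hd⟩ := Submodule.mem_span_singleton.1 b
      rw [← hd]; simp [hp]
  rw [h3] at h2
  unfold NN
  have h4 : (((inF v S (Submodule.span ℝ {v p, v y})).filter fun i => φ (v i) ≠ 0).card : ℤ)
     = (inF v S (Submodule.span ℝ {v p, v y})).card - (inF v S (Submodule.span ℝ {v p})).card := by
    rw [← h2]; push_cast; ring
  rw [h4] at h
  convert h using 1
  ring

/-- `p` is the only member of `S` on its line. -/
def Simp (v : ι → E) (S : Finset ι) (p : ι) : Prop := ∀ i ∈ S, v i ∈ Submodule.span ℝ {v p} → i = p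

lemma Simp.card {v : ι → E} {S : Finset ι} {p : ι} (h : Simp v S p) (hp : p ∈ S) :
    (inF v S (Submodule.span ℝ {v p})).card = 1 := by
  rw [Finset.card_eq_one]
  refine ⟨p, ?_⟩
  ext i
  simp only [mem_inF, Finset.mem_singleton]
  exact ⟨fun ⟨a, b⟩ => h i a b, fun a => by subst a; exact ⟨hp, Submodule.mem_span_singleton_self _⟩⟩

lemma exists_sep {x y : E} (h : y ∉ Submodule.span ℝ {x}) :
    ∃ φ : E →ₗ[ℝ] ℝ, φ x = 0 ∧ φ y = 1 := by
  obtain ⟨φ, h1, h2⟩ := Submodule.exists_le_ker_of_notMem h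
  refine ⟨(φ y)⁻¹ • φ, ?_, by simp [h1]⟩
  have : φ x = 0 := h2 (Submodule.mem_span_singleton_self _)
  simp [this]

lemma odd_of_bal {v : ι → E} {S : Finset ι} {p y : ι} (hp : p ∈ S) (hs : Simp v S p)
    (hy : v y ∉ Submodule.span ℝ {v p}) (hB : Bal v S p y) : Odd (NN v S p y) := by
  obtain ⟨φ, h1, h2⟩ := exists_sep hy
  have h := line_parity v S p y φ h1 (by rw [h2]; norm_num)
  rw [hB φ h1, hs.card hp] at h
  rw [Int.even_iff] at h
  rw [Nat.odd_iff]
  omega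

lemma bal_of_odd {v : ι → E} {S : Finset ι} (hA : AF v S) (hD : ∀ φ, ff v S φ ≤ 2)
    {p y : ι} (hp : p ∈ S) (hs : Simp v S p) (hN : Odd (NN v S p y)) : Bal v S p y := by
  intro φ hφ
  by_cases hy : φ (v y) = 0
  · refine Finset.sum_eq_zero fun i hi => ?_
    obtain ⟨d, e, hde⟩ := Submodule.mem_span_pair.1 (mem_inF.1 hi).2
    rw [← hde]; simp [hφ, hy, sg_zero]
  have h := line_parity v S p y φ hφ hy
  rw [hs.card hp] at h
  set F := Submodule.span ℝ {v p, v y}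
  have hpF : p ∈ inF v S F := mem_inF.2 ⟨hp, Submodule.subset_span (by simp)⟩
  have hA' : AF v (inF v S F) := hA.mono (Finset.filter_subset _ _)
  have h1 := ff_add_line_card_le v _ hA' 2 (ff_restrict_le v S F 2 hD) hpF φ hφ
  have h2 := ff_add_line_card_le v _ hA' 2 (ff_restrict_le v S F 2 hD) hpF (-φ) (by simp [hφ])
  have h3 := line_card_pos v hpF
  rw [ff_neg] at h2
  rw [Int.even_iff] at h
  rw [Nat.odd_iff] at hN
  omega

lemma nonsimple_card {v : ι → E} {S : Finset ι} (hA : AF v S) (hD : ∀ φ, ff v S φ ≤ 2)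
    {p : ι} (hp : p ∈ S) (hs : ¬ Simp v S p) : (inF v S (Submodule.span ℝ {v p})).card = 2 := by
  have h1 := line_card_le v S hA 2 hD hp
  unfold Simp at hs
  push Not at hs
  obtain ⟨i, hi, him, hip⟩ := hs
  have h2 : 1 < (inF v S (Submodule.span ℝ {v p})).card :=
    Finset.one_lt_card.2 ⟨i, mem_inF.2 ⟨hi, him⟩, p, self_mem_line v hp, hip⟩
  omega

lemma even_of_nonsimple {v : ι → E} {S : Finset ι} (hA : AF v S) (hD : ∀ φ, ff v S φ ≤ 2)
    {p y : ι} (hp : p ∈ S) (hs : ¬ Simp v S p) (hy : v y ∉ Submodule.span ℝ {v p}) :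
    Even (NN v S p y) := by
  obtain ⟨φ, h1, h2⟩ := exists_sep hy
  have h := line_parity v S p y φ h1 (by rw [h2]; norm_num)
  have hc := nonsimple_card hA hD hp hs
  rw [bal_of_card v S hA 2 hD hp (by rw [hc]; norm_num) y φ h1, hc] at h
  rw [Int.even_iff] at h
  rw [Nat.even_iff]
  omega

lemma span_single_symm {x y : E} (hy : y ≠ 0) (h : y ∈ Submodule.span ℝ {x}) :
    x ∈ Submodule.span ℝ {y} := by
  obtain ⟨c, rfl⟩ := Submodule.mem_span_singleton.1 h
  have hc : c ≠ 0 := by rintro rfl; simp at hy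
  exact Submodule.mem_span_singleton.2 ⟨c⁻¹, by rw [smul_smul, inv_mul_cancel₀ hc, one_smul]⟩

/-- on an even line through a simple point there is another simple point -/
lemma exists_other_simple {v : ι → E} {S : Finset ι} (hA : AF v S) (hD : ∀ φ, ff v S φ ≤ 2)
    {p y : ι} (hp : p ∈ S) (hs : Simp v S p) (hN : Even (NN v S p y)) :
    ∃ q ∈ S, q ≠ p ∧ v q ∈ Submodule.span ℝ {v p, v y} ∧ Simp v S q := by
  by_contra hcon
  push Not at hcon
  set F := Submodule.span ℝ {v p, v y} with hF
  set T := (inF v S F).erase p with hT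
  have hpF : p ∈ inF v S F := mem_inF.2 ⟨hp, Submodule.subset_span (by simp)⟩
  have hTm : ∀ i ∈ T, i ∈ S ∧ v i ∈ F ∧ i ≠ p := by
    intro i hi
    obtain ⟨a, b⟩ := Finset.mem_erase.1 hi
    exact ⟨(mem_inF.1 b).1, (mem_inF.1 b).2, a⟩
  have hex : ∀ i ∈ T, ∃ j ∈ S, v j ∈ Submodule.span ℝ {v i} ∧ j ≠ i := by
    intro i hi
    obtain ⟨a, b, c⟩ := hTm i hi
    have := hcon i a c b
    unfold Simp at this
    push Not at this
    exact this
  choose! g hgS hgm hgn using hex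
  have hgT : ∀ i ∈ T, g i ∈ T := by
    intro i hi
    obtain ⟨a, b, c⟩ := hTm i hi
    refine Finset.mem_erase.2 ⟨?_, mem_inF.2 ⟨hgS i hi, ?_⟩⟩
    · intro h
      have h1 := hgm i hi
      rw [h] at h1
      exact c (hs i a (span_single_symm (hA.ne_zero hp) h1))
    · exact (Submodule.span_singleton_le_iff_mem _ _).2 b (hgm i hi)
  have hgg : ∀ i ∈ T, g (g i) = i := by
    intro i hi
    obtain ⟨a, b, c⟩ := hTm i hi
    by_contra hne
    have hgi := hgT i hi
    have hcard := nonsimple_card hA hD a (hcon i a c b)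
    have h3 : ({i, g i, g (g i)} : Finset ι) ⊆ inF v S (Submodule.span ℝ {v i}) := by
      intro j hj
      simp only [Finset.mem_insert, Finset.mem_singleton] at hj
      rcases hj with rfl | rfl | rfl
      · exact self_mem_line v a
      · exact mem_inF.2 ⟨hgS i hi, hgm i hi⟩
      · exact mem_inF.2 ⟨hgS _ hgi,
          (Submodule.span_singleton_le_iff_mem _ _).2 (hgm i hi) (hgm _ hgi)⟩
    have h4 := Finset.card_le_card h3
    rw [Finset.card_eq_three.2 ⟨i, g i, g (g i), (hgn i hi).symm, Ne.symm hne, (hgn _ hgi).symm, rfl⟩] at h4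
    omega
  have hsum : ∑ i ∈ T, (1 : ZMod 2) = 0 := by
    refine Finset.sum_involution (fun i _ => g i) ?_ ?_ ?_ ?_
    · intro i _; decide
    · intro i hi _; exact hgn i hi
    · exact hgT
    · exact hgg
  have hev : Even T.card := by
    rw [Finset.sum_const, nsmul_one, ZMod.natCast_eq_zero_iff_even] at hsum
    exact hsum
  have : T.card + 1 = NN v S p y := Finset.card_erase_add_one hpF
  rw [← this] at hN
  rw [Nat.even_iff] at hN hev
  omega

/-- a pair of simple points on a line with an even number of points -/
def EP (v : ι → E) (S : Finset ι) (p q : ι) : Prop :=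
  p ∈ S ∧ q ∈ S ∧ Simp v S p ∧ Simp v S q ∧ p ≠ q ∧ Even (NN v S p q)

lemma EP.symm {v : ι → E} {S : Finset ι} {p q : ι} (h : EP v S p q) : EP v S q p :=
  ⟨h.2.1, h.1, h.2.2.2.1, h.2.2.1, h.2.2.2.2.1.symm, by rw [NN_comm]; exact h.2.2.2.2.2⟩

lemma EP.notMem {v : ι → E} {S : Finset ι} {p q : ι} (h : EP v S p q) :
    v q ∉ Submodule.span ℝ {v p} := fun h' => h.2.2.2.2.1 (h.2.2.1 q h.2.1 h').symm

lemma exists_EP (v : ι → E) (S : Finset ι) [FiniteDimensional ℝ E] (hA : AF v S)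
    (hD : ∀ φ, ff v S φ ≤ 2) (hr : 3 ≤ Module.finrank ℝ (Submodule.span ℝ (v '' (S : Set ι)))) :
    ∃ p q, EP v S p q := by
  by_contra hcon
  push Not at hcon
  have hall : ∀ p ∈ S, ∀ y, Bal v S p y := by
    intro p hp y
    by_cases hs : Simp v S p
    · refine bal_of_odd hA hD hp hs ?_
      by_contra hN
      rw [Nat.not_odd_iff_even] at hN
      obtain ⟨q, hq, hqp, hqm, hqs⟩ := exists_other_simple hA hD hp hs hN
      refine hcon p q ⟨hp, hq, hs, hqs, hqp.symm, ?_⟩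
      have : Submodule.span ℝ {v p, v q} = Submodule.span ℝ {v p, v y} := by
        apply le_antisymm
        · rw [Submodule.span_le]
          rintro w (rfl | hw)
          · exact Submodule.subset_span (by simp)
          · rw [Set.mem_singleton_iff.1 hw]; exact hqm
        · rw [Submodule.span_le]
          rintro w (rfl | hw)
          · exact Submodule.subset_span (by simp)
          · rw [Set.mem_singleton_iff.1 hw]
            obtain ⟨d, c, hdc⟩ := Submodule.mem_span_pair.1 hqm
            have hc : c ≠ 0 := by
              rintro rfl
              apply hqp
              apply hs q hq
              rw [← hdc]
              simpa using Submodule.smul_mem _ _ (Submodule.mem_span_singleton_self _)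
            refine Submodule.mem_span_pair.2 ⟨-(d / c), c⁻¹, ?_⟩
            rw [← hdc, smul_add, smul_smul c⁻¹ c, inv_mul_cancel₀ hc]
            module
      unfold NN at hN ⊢
      rw [this]
      exact hN
    · exact bal_of_card v S hA 2 hD hp (by rw [nonsimple_card hA hD hp hs]; norm_num) y
  obtain ⟨p, hp, q, hq, x, hx, hli⟩ := exists_three v S hr
  exact key_lemma v S hA hD hp hq hx hli fun y _ _ _ => ⟨hall p hp y, hall q hq y⟩

lemma finrank_pair {a b : E} (ha : a ≠ 0) (hb : b ∉ Submodule.span ℝ {a}) :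
    Module.finrank ℝ (Submodule.span ℝ {a, b}) = 2 := by
  have hli : LinearIndependent ℝ ![a, b] := by
    rw [LinearIndependent.pair_iff' ha]
    intro c hc
    exact hb (Submodule.mem_span_singleton.2 ⟨c, hc⟩)
  have h := finrank_span_eq_card hli
  have hr : Set.range ![a, b] = {a, b} := by
    ext x
    simp [eq_comm, or_comm]
  rw [hr] at h
  simpa using h

lemma cover_lemma (v : ι → E) (S : Finset ι) [FiniteDimensional ℝ E] (hA : AF v S)
    (hD : ∀ φ, ff v S φ ≤ 2)
    (hr : ∀ G : Submodule ℝ E, Module.finrank ℝ G ≤ 3 → ∃ i ∈ S, v i ∉ G)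
    {p q : ι} (h : EP v S p q) {Hp Hq : Submodule ℝ E}
    (hp : v p ∈ Hp) (hp3 : Module.finrank ℝ Hp ≤ 3) (hpB : ∀ y ∈ S, v y ∉ Hp → Bal v S p y)
    (hq : v q ∈ Hq) (hq3 : Module.finrank ℝ Hq ≤ 3) (hqB : ∀ y ∈ S, v y ∉ Hq → Bal v S q y) :
    v q ∈ Hp ∧ v p ∈ Hq ∧ Module.finrank ℝ Hp = 3 ∧ (∀ s ∈ S, v s ∈ Hp ∨ v s ∈ Hq) := by
  obtain ⟨pS, qS, ps, qs, pq, hN⟩ := id h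
  have hqHp : v q ∈ Hp := by
    by_contra hc
    exact Nat.not_even_iff_odd.2 (odd_of_bal pS ps h.notMem (hpB q qS hc)) hN
  have hpHq : v p ∈ Hq := by
    by_contra hc
    have := odd_of_bal qS qs h.symm.notMem (hqB p pS hc)
    rw [NN_comm] at this
    exact Nat.not_even_iff_odd.2 this hN
  have hle1 : Submodule.span ℝ {v p, v q} ≤ Hp := by
    rw [Submodule.span_le]
    rintro w (rfl | hw)
    · exact hp
    · rw [Set.mem_singleton_iff.1 hw]; exact hqHp
  have hle2 : Submodule.span ℝ {v p, v q} ≤ Hq := by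
    rw [Submodule.span_le]
    rintro w (rfl | hw)
    · exact hpHq
    · rw [Set.mem_singleton_iff.1 hw]; exact hq
  have hcov : ∀ s ∈ S, v s ∈ Hp ∨ v s ∈ Hq := by
    intro x hx
    by_contra hc
    push Not at hc
    have hli := li3 (hA.ne_zero pS) h.notMem (fun hm => hc.1 (hle1 hm))
    refine key_lemma v S hA hD pS qS hx hli ?_
    intro y hy hyW hyn
    obtain ⟨a, z, hz, hyz⟩ := Submodule.mem_span_insert.1 hyW
    obtain ⟨b, c, hbc⟩ := Submodule.mem_span_pair.1 hz
    have hc0 : c ≠ 0 := by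
      rintro rfl
      apply hyn
      rw [Submodule.mem_span_pair]
      exact ⟨a, b, by rw [hyz, ← hbc]; simp⟩
    have hxy : v x = c⁻¹ • (v y - (a • v p + b • v q)) := by
      rw [hyz, ← hbc]
      have : a • v p + (b • v q + c • v x) - (a • v p + b • v q) = c • v x := by abel
      rw [this, smul_smul, inv_mul_cancel₀ hc0, one_smul]
    have hgen : ∀ G : Submodule ℝ E, v p ∈ G → v q ∈ G → v x ∉ G → v y ∉ G := by
      intro G h1 h2 h3 h4
      apply h3
      rw [hxy]
      exact G.smul_mem _ (G.sub_mem h4 (G.add_mem (G.smul_mem _ h1) (G.smul_mem _ h2)))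
    exact ⟨hpB y hy (hgen Hp hp hqHp hc.1), hqB y hy (hgen Hq hpHq hq hc.2)⟩
  refine ⟨hqHp, hpHq, ?_, hcov⟩
  by_contra hne
  have h2 := finrank_pair (hA.ne_zero pS) h.notMem
  have heq : Submodule.span ℝ {v p, v q} = Hp :=
    Submodule.eq_of_le_of_finrank_le hle1 (by omega)
  obtain ⟨i, hi, hiH⟩ := hr Hq hq3
  rcases hcov i hi with h' | h'
  · exact hiH (hle2 (heq ▸ h'))
  · exact hiH h'

lemma bal_transfer (v : ι → E) (S : Finset ι) (hA : AF v S) {p y : ι} (hy : y ∈ S)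
    (hB : Bal v S p y) (H G : Submodule ℝ E) (hp : v p ∈ H) (hyH : v y ∉ H)
    (hG : ∀ i ∈ S, v i ∉ H → v i ∈ G) : v p ∈ G := by
  have hyp : v y ∉ Submodule.span ℝ {v p} := fun h =>
    hyH ((Submodule.span_singleton_le_iff_mem _ _).2 hp h)
  obtain ⟨φ, h1, h2⟩ := exists_sep hyp
  have h0 := hB φ h1
  have hex : ∃ i ∈ inF v S (Submodule.span ℝ {v p, v y}), φ (v i) < 0 := by
    by_contra hc
    push Not at hc
    have hyF : y ∈ inF v S (Submodule.span ℝ {v p, v y}) :=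
      mem_inF.2 ⟨hy, Submodule.subset_span (by simp)⟩
    have hnn : ∀ i ∈ inF v S (Submodule.span ℝ {v p, v y}), 0 ≤ sg (φ (v i)) := by
      intro i hi
      rcases (hc i hi).lt_or_eq with h | h
      · rw [sg_pos h]; norm_num
      · rw [← h, sg_zero]
    have := (Finset.sum_eq_zero_iff_of_nonneg hnn).1 h0 y hyF
    rw [h2, sg_pos one_pos] at this
    norm_num at this
  obtain ⟨i, hi, hneg⟩ := hex
  obtain ⟨hiS, hiF⟩ := mem_inF.1 hi
  obtain ⟨d, c, hdc⟩ := Submodule.mem_span_pair.1 hiF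
  have hc : c < 0 := by
    rw [← hdc] at hneg
    simpa [h1, h2] using hneg
  have hd : d ≠ 0 := by
    rintro rfl
    have := hA y hy i hiS c (by rw [← hdc]; simp)
    linarith
  have hiH : v i ∉ H := by
    intro hm
    apply hyH
    have : v y = c⁻¹ • (v i - d • v p) := by
      rw [← hdc, add_sub_cancel_left, smul_smul, inv_mul_cancel₀ hc.ne, one_smul]
    rw [this]
    exact H.smul_mem _ (H.sub_mem hm (H.smul_mem _ hp))
  have : v p = d⁻¹ • (v i - c • v y) := by
    rw [← hdc, add_sub_cancel_right, smul_smul, inv_mul_cancel₀ hd, one_smul]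
  rw [this]
  exact G.smul_mem _ (G.sub_mem (hG i hiS hiH) (G.smul_mem _ (hG y hy hyH)))

lemma inf_eq_pair [FiniteDimensional ℝ E] {H G : Submodule ℝ E} {a b x : E} (ha : a ≠ 0)
    (hb : b ∉ Submodule.span ℝ {a}) (hH : Module.finrank ℝ H ≤ 3)
    (haH : a ∈ H) (hbH : b ∈ H) (haG : a ∈ G) (hbG : b ∈ G) (hx : x ∈ H) (hxG : x ∉ G) :
    H ⊓ G = Submodule.span ℝ {a, b} := by
  symm
  apply Submodule.eq_of_le_of_finrank_le
  · rw [Submodule.span_le]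
    rintro w (rfl | hw)
    · exact ⟨haH, haG⟩
    · rw [Set.mem_singleton_iff.1 hw]; exact ⟨hbH, hbG⟩
  · rw [finrank_pair ha hb]
    have : H ⊓ G < H := lt_of_le_of_ne inf_le_left fun h => hxG ((inf_eq_left.1 h) hx)
    have := Submodule.finrank_lt_finrank_of_lt this
    omega

lemma rank_four (v : ι → E) (S : Finset ι) [FiniteDimensional ℝ E] (hA : AF v S)
    (hD : ∀ φ, ff v S φ ≤ 2) (hr : 4 ≤ Module.finrank ℝ (Submodule.span ℝ (v '' (S : Set ι)))) :
    ∃ P Q : Submodule ℝ E, (∀ s ∈ S, v s ∈ P ∨ v s ∈ Q) ∧ (∀ s ∈ S, ¬ (v s ∈ P ∧ v s ∈ Q)) ∧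
      Odd (inF v S P).card ∧ Odd (inF v S Q).card ∧ 2 ≤ (inF v S P).card ∧
      2 ≤ (inF v S Q).card := by
  have hr' : ∀ G : Submodule ℝ E, Module.finrank ℝ G ≤ 3 → ∃ i ∈ S, v i ∉ G := by
    intro G hG
    by_contra hall
    push Not at hall
    have : Submodule.span ℝ (v '' (S : Set ι)) ≤ G := by
      rw [Submodule.span_le]
      rintro _ ⟨i, hi, rfl⟩
      exact hall i hi
    have := Submodule.finrank_mono this
    omega
  obtain ⟨p, q, hpq⟩ := exists_EP v S hA hD (by omega)
  have hHex : ∀ p ∈ S, ∃ H : Submodule ℝ E, v p ∈ H ∧ Module.finrank ℝ H ≤ 3 ∧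
      ∀ y ∈ S, v y ∉ H → Bal v S p y := fun p hp => exists_H v S hA hD hp
  choose! H hHm hH3 hHB using hHex
  have cov : ∀ p q, EP v S p q → v q ∈ H p ∧ v p ∈ H q ∧ Module.finrank ℝ (H p) = 3 ∧
      (∀ s ∈ S, v s ∈ H p ∨ v s ∈ H q) := fun p q h =>
    cover_lemma v S hA hD hr' h (hHm p h.1) (hH3 p h.1) (hHB p h.1) (hHm q h.2.1) (hH3 q h.2.1)
      (hHB q h.2.1)
  obtain ⟨pS, qS, ps, qs, pq, -⟩ := id hpq
  obtain ⟨hqHp, hpHq, -, hcov⟩ := cov p q hpq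
  -- points off `H q` and off `H p` are simple
  have simpX : ∀ (p _q : ι), p ∈ S → Simp v S p → ∀ y ∈ S, v y ∉ H p → Simp v S y ∧ Odd (NN v S p y) := by
    intro p _ hp hs y hy hyH
    have hyp : v y ∉ Submodule.span ℝ {v p} := fun h =>
      hyH ((Submodule.span_singleton_le_iff_mem _ _).2 (hHm p hp) h)
    have hodd := odd_of_bal hp hs hyp (hHB p hp y hy hyH)
    refine ⟨?_, hodd⟩
    by_contra hns
    have := even_of_nonsimple hA hD hy hns
      (y := p) (fun h => hyp (span_single_symm (hA.ne_zero hp) h))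
    rw [NN_comm] at this
    exact Nat.not_even_iff_odd.2 hodd this
  obtain ⟨x, hx, hxH⟩ := hr' (H q) (hH3 q qS)
  obtain ⟨y, hy, hyH⟩ := hr' (H p) (hH3 p pS)
  have hep : ∀ x ∈ S, v x ∉ H q → ∀ y ∈ S, v y ∉ H p → EP v S x y := by
    intro x hx hxH y hy hyH
    have hxs := (simpX q q qS qs x hx hxH).1
    have hys := (simpX p p pS ps y hy hyH).1
    have hxp := (hcov x hx).resolve_right hxH
    have hyq := (hcov y hy).resolve_left hyH
    have hne : x ≠ y := by rintro rfl; exact hyH hxp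
    refine ⟨hx, hy, hxs, hys, hne, ?_⟩
    have : inF v S (Submodule.span ℝ {v x, v y}) = {x, y} := by
      ext s
      simp only [mem_inF, Finset.mem_insert, Finset.mem_singleton]
      constructor
      · rintro ⟨hs, hm⟩
        obtain ⟨c, d, hcd⟩ := Submodule.mem_span_pair.1 hm
        rcases hcov s hs with h | h
        · left
          apply hxs s hs
          have hd : d = 0 := by
            by_contra hd
            apply hyH
            have : v y = d⁻¹ • (v s - c • v x) := by
              rw [← hcd, add_sub_cancel_left, smul_smul, inv_mul_cancel₀ hd, one_smul]
            rw [this]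
            exact (H p).smul_mem _ ((H p).sub_mem h ((H p).smul_mem _ hxp))
          rw [← hcd, hd]
          simpa using Submodule.smul_mem _ _ (Submodule.mem_span_singleton_self _)
        · right
          apply hys s hs
          have hd : c = 0 := by
            by_contra hd
            apply hxH
            have : v x = c⁻¹ • (v s - d • v y) := by
              rw [← hcd, add_sub_cancel_right, smul_smul, inv_mul_cancel₀ hd, one_smul]
            rw [this]
            exact (H q).smul_mem _ ((H q).sub_mem h ((H q).smul_mem _ hyq))
          rw [← hcd, hd]
          simpa using Submodule.smul_mem _ _ (Submodule.mem_span_singleton_self _)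
      · rintro (rfl | rfl)
        · exact ⟨hx, Submodule.subset_span (by simp)⟩
        · exact ⟨hy, Submodule.subset_span (by simp)⟩
    unfold NN
    rw [this, Finset.card_pair hne]
    exact even_two
  have hxp := (hcov x hx).resolve_right hxH
  have hyq := (hcov y hy).resolve_left hyH
  obtain ⟨hyHx, hxHy, -, hcov2⟩ := cov x y (hep x hx hxH y hy hyH)
  have hYx : ∀ i ∈ S, v i ∉ H p → v i ∈ H x := fun i hi hiH => (cov x i (hep x hx hxH i hi hiH)).1
  have hXy : ∀ i ∈ S, v i ∉ H q → v i ∈ H y :=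
    fun i hi hiH => (cov i y (hep i hi hiH y hy hyH)).2.1
  have hpx : v p ∈ H x := bal_transfer v S hA hy (hHB p pS y hy hyH) (H p) (H x) (hHm p pS) hyH hYx
  have hqy : v q ∈ H y := bal_transfer v S hA hx (hHB q qS x hx hxH) (H q) (H y) (hHm q qS) hxH hXy
  have hyp : v y ∉ Submodule.span ℝ {v p} := fun h =>
    hyH ((Submodule.span_singleton_le_iff_mem _ _).2 (hHm p pS) h)
  have hxq : v x ∉ Submodule.span ℝ {v q} := fun h =>
    hxH ((Submodule.span_singleton_le_iff_mem _ _).2 (hHm q qS) h)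
  have hQ : H x ⊓ H q = Submodule.span ℝ {v p, v y} :=
    inf_eq_pair (hA.ne_zero pS) hyp (hH3 x hx) hpx hyHx hpHq hyq (hHm x hx) hxH
  have hP : H y ⊓ H p = Submodule.span ℝ {v q, v x} :=
    inf_eq_pair (hA.ne_zero qS) hxq (hH3 y hy) hqy hxHy hqHp hxp (hHm y hy) hyH
  have two : ∀ a b, a ∈ S → b ∈ S → v b ∉ Submodule.span ℝ {v a} →
      2 ≤ (inF v S (Submodule.span ℝ {v a, v b})).card := by
    intro a b ha hb hab
    refine Finset.one_lt_card.2 ⟨a, mem_inF.2 ⟨ha, Submodule.subset_span (by simp)⟩,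
      b, mem_inF.2 ⟨hb, Submodule.subset_span (by simp)⟩, ?_⟩
    rintro rfl
    exact hab (Submodule.mem_span_singleton_self _)
  refine ⟨Submodule.span ℝ {v q, v x}, Submodule.span ℝ {v p, v y}, ?_, ?_,
    (simpX q q qS qs x hx hxH).2, (simpX p p pS ps y hy hyH).2, two q x qS hx hxq, two p y pS hy hyp⟩
  · intro s hs
    rw [← hP, ← hQ]
    by_cases h1 : v s ∈ H p
    · by_cases h2 : v s ∈ H q
      · rcases hcov2 s hs with h3 | h3
        · exact Or.inr ⟨h3, h2⟩
        · exact Or.inl ⟨h3, h1⟩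
      · exact Or.inl ⟨hXy s hs h2, h1⟩
    · exact Or.inr ⟨hYx s hs h1, (hcov s hs).resolve_left h1⟩
  · rintro s hs ⟨h1, h2⟩
    have h1' := h1
    have h2' := h2
    rw [← hP] at h1'
    rw [← hQ] at h2'
    obtain ⟨c, d, hcd⟩ := Submodule.mem_span_pair.1 h1
    obtain ⟨a, b, hab⟩ := Submodule.mem_span_pair.1 h2
    have hd : d = 0 := by
      by_contra hd
      apply hxH
      have : v x = d⁻¹ • (v s - c • v q) := by
        rw [← hcd, add_sub_cancel_left, smul_smul, inv_mul_cancel₀ hd, one_smul]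
      rw [this]
      exact (H q).smul_mem _ ((H q).sub_mem h2'.2 ((H q).smul_mem _ (hHm q qS)))
    have hb : b = 0 := by
      by_contra hb
      apply hyH
      have : v y = b⁻¹ • (v s - a • v p) := by
        rw [← hab, add_sub_cancel_left, smul_smul, inv_mul_cancel₀ hb, one_smul]
      rw [this]
      exact (H p).smul_mem _ ((H p).sub_mem h1'.2 ((H p).smul_mem _ (hHm p pS)))
    subst hd hb
    simp only [zero_smul, add_zero] at hcd hab
    have e1 := ps s hs (Submodule.mem_span_singleton.2 ⟨a, hab⟩)
    have e2 := qs s hs (Submodule.mem_span_singleton.2 ⟨c, hcd⟩)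
    exact pq (e1.symm.trans e2)


/-! ## Codegrees of subfamilies -/

/-- number of nonpositive values on the subfamily indexed by `S` -/
def np (v : ι → E) (S : Finset ι) (φ : E →ₗ[ℝ] ℝ) : ℕ := (S.filter fun i => φ (v i) ≤ 0).card

/-- rank of the subfamily indexed by `S` -/
def rk (v : ι → E) (S : Finset ι) : ℕ := Module.finrank ℝ (Submodule.span ℝ (v '' (S : Set ι)))

/-- codegree of the subfamily indexed by `S` -/
def kap (v : ι → E) (S : Finset ι) : ℕ := codegStar (subfam v S)

lemma nonposCount_subfam (v : ι → E) (S : Finset ι) (φ : E →ₗ[ℝ] ℝ) :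
    nonposCount φ (subfam v S) = np v S φ := by
  unfold nonposCount np subfam
  rw [← Finset.card_map (Function.Embedding.subtype (fun i => i ∈ S))]
  congr 1
  ext i
  simp only [Finset.mem_map, Finset.mem_filter, Finset.mem_univ, true_and,
    Function.Embedding.subtype_apply, Subtype.exists, exists_and_left, exists_prop]
  constructor
  · rintro ⟨a, h, b, rfl⟩
    exact ⟨b, h⟩
  · rintro ⟨b, h⟩
    exact ⟨i, h, b, rfl⟩

lemma exists_ne_zero_functional [Nontrivial E] : ∃ φ : E →ₗ[ℝ] ℝ, φ ≠ 0 := by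
  obtain ⟨x, hx⟩ := exists_ne (0 : E)
  obtain ⟨η, h⟩ := exists_pos_functional hx
  refine ⟨η, ?_⟩
  rintro rfl
  simp at h

lemma kap_eq [Nontrivial E] (v : ι → E) (S : Finset ι) :
    kap v S = sInf {k | ∃ φ : E →ₗ[ℝ] ℝ, φ ≠ 0 ∧ np v S φ = k} := by
  unfold kap codegStar
  rw [if_pos (inferInstance : Nontrivial E)]
  simp only [nonposCount_subfam]

lemma kap_exists [Nontrivial E] (v : ι → E) (S : Finset ι) :
    ∃ φ : E →ₗ[ℝ] ℝ, φ ≠ 0 ∧ np v S φ = kap v S := by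
  have hne : {k | ∃ φ : E →ₗ[ℝ] ℝ, φ ≠ 0 ∧ np v S φ = k}.Nonempty := by
    obtain ⟨φ, h⟩ := exists_ne_zero_functional (E := E)
    exact ⟨_, φ, h, rfl⟩
  rw [kap_eq]
  exact Nat.sInf_mem hne

lemma kap_le [Nontrivial E] (v : ι → E) (S : Finset ι) (φ : E →ₗ[ℝ] ℝ) : kap v S ≤ np v S φ := by
  have h0 : ∀ φ : E →ₗ[ℝ] ℝ, φ ≠ 0 → kap v S ≤ np v S φ := by
    intro φ h
    rw [kap_eq]
    exact Nat.sInf_le ⟨φ, h, rfl⟩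
  by_cases h : φ = 0
  · obtain ⟨ψ, hψ⟩ := exists_ne_zero_functional (E := E)
    refine (h0 ψ hψ).trans ?_
    subst h
    unfold np
    simpa using Finset.card_filter_le S _
  · exact h0 φ h

lemma kap_generic [Nontrivial E] (v : ι → E) (S : Finset ι) :
    ∃ φ : E →ₗ[ℝ] ℝ, (∀ i, v i ≠ 0 → φ (v i) ≠ 0) ∧ np v S φ = kap v S := by
  obtain ⟨φ, -, hφ⟩ := kap_exists v S
  obtain ⟨η, -, hη⟩ := exists_generic v (⊥ : Submodule ℝ E)
  obtain ⟨χ, c1, c2, -⟩ := perturb v φ η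
  refine ⟨χ, ?_, le_antisymm ?_ (kap_le v S χ)⟩
  · intro i hi h0
    by_cases h : φ (v i) = 0
    · have := c2 i h
      rw [h0, sg_zero] at this
      rcases lt_or_gt_of_ne (hη i (by simpa using hi)) with h' | h'
      · rw [sg_neg h'] at this; omega
      · rw [sg_pos h'] at this; omega
    · have := c1 i h
      rw [h0, sg_zero] at this
      rcases lt_or_gt_of_ne h with h' | h'
      · rw [sg_neg h'] at this; omega
      · rw [sg_pos h'] at this; omega
  · rw [← hφ]
    unfold np
    apply Finset.card_le_card
    intro i hi
    rw [Finset.mem_filter] at hi ⊢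
    refine ⟨hi.1, ?_⟩
    by_contra hc
    push Not at hc
    have := c1 i hc.ne'
    rw [sg_pos hc] at this
    rcases hi.2.lt_or_eq with h' | h'
    · rw [sg_neg h'] at this; omega
    · rw [h', sg_zero] at this; omega

lemma np_split (v : ι → E) {S B : Finset ι} (hB : B ⊆ S) (φ : E →ₗ[ℝ] ℝ) :
    np v S φ = np v (S \ B) φ + np v B φ := by
  unfold np
  simp only [Finset.card_filter]
  exact (Finset.sum_sdiff hB).symm

lemma kap_empty [Nontrivial E] (v : ι → E) : kap v ∅ = 0 := by
  obtain ⟨φ, -, h⟩ := kap_exists v ∅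
  rw [← h]
  simp [np]

lemma kap_block [Nontrivial E] (v : ι → E) {S B : Finset ι} (hB : B ⊆ S)
    (h1 : ∀ φ, 1 ≤ np v B φ)
    (h2 : ∀ φ : E →ₗ[ℝ] ℝ, (∀ i, v i ≠ 0 → φ (v i) ≠ 0) → np v B φ = 1) :
    kap v S = kap v (S \ B) + 1 := by
  apply le_antisymm
  · obtain ⟨φ, h, hφ⟩ := kap_generic v (S \ B)
    have := kap_le v S φ
    rw [np_split v hB, h2 φ h] at this
    omega
  · obtain ⟨φ, -, hφ⟩ := kap_exists v S
    rw [np_split v hB] at hφ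
    have := kap_le v (S \ B) φ
    have := h1 φ
    omega

/-- the inductive statement -/
def Good (v : ι → E) (S : Finset ι) : Prop :=
  ∃ 𝒯 : Finset (Finset ι), (∀ A ∈ 𝒯, ∀ B ∈ 𝒯, A ≠ B → Disjoint A B) ∧
    (∀ T ∈ 𝒯, T ⊆ S ∧ 1 ≤ kap v T) ∧ kap v S = ∑ T ∈ 𝒯, kap v T ∧
    2 * (kap v S : ℤ) + rk v S - S.card ≤ 𝒯.card

lemma good_step [Nontrivial E] (v : ι → E) {S B : Finset ι} (hB : B ⊆ S)
    (h1 : ∀ φ, 1 ≤ np v B φ)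
    (h2 : ∀ φ : E →ₗ[ℝ] ℝ, (∀ i, v i ≠ 0 → φ (v i) ≠ 0) → np v B φ = 1)
    (hrk : rk v S + 1 ≤ rk v (S \ B) + B.card) (hg : Good v (S \ B)) : Good v S := by
  obtain ⟨𝒯, t1, t2, t3, t4⟩ := hg
  have hkS := kap_block v hB h1 h2
  have hkB : kap v B = 1 := by
    have := kap_block v (subset_refl B) h1 h2
    rw [Finset.sdiff_self, kap_empty] at this
    omega
  have hdis : ∀ T ∈ 𝒯, Disjoint T B := fun T hT =>
    Finset.disjoint_of_subset_left (t2 T hT).1 Finset.sdiff_disjoint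
  have hnot : B ∉ 𝒯 := by
    intro h
    have := disjoint_self.1 (hdis B h)
    rw [this] at hkB
    rw [Finset.bot_eq_empty, kap_empty] at hkB
    omega
  refine ⟨insert B 𝒯, ?_, ?_, ?_, ?_⟩
  · intro A hA C hC hne
    rw [Finset.mem_insert] at hA hC
    rcases hA with rfl | hA
    · rcases hC with rfl | hC
      · exact absurd rfl hne
      · exact (hdis C hC).symm
    · rcases hC with rfl | hC
      · exact hdis A hA
      · exact t1 A hA C hC hne
  · intro T hT
    rw [Finset.mem_insert] at hT
    rcases hT with rfl | hT
    · exact ⟨hB, hkB.ge⟩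
    · exact ⟨(t2 T hT).1.trans Finset.sdiff_subset, (t2 T hT).2⟩
  · rw [Finset.sum_insert hnot, hkS, hkB, t3, add_comm]
  · rw [Finset.card_insert_of_notMem hnot]
    have := Finset.card_sdiff_add_card_eq_card hB
    push_cast
    omega

lemma rk_mono [FiniteDimensional ℝ E] (v : ι → E) {S T : Finset ι} (h : T ⊆ S) :
    rk v T ≤ rk v S :=
  Submodule.finrank_mono (Submodule.span_mono (Set.image_mono (by exact_mod_cast h)))

lemma rk_le_card (v : ι → E) (S : Finset ι) : rk v S ≤ S.card := by
  unfold rk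
  rw [← Finset.coe_image]
  exact (finrank_span_finset_le_card _).trans Finset.card_image_le

lemma ff_generic (v : ι → E) (S : Finset ι) (φ : E →ₗ[ℝ] ℝ) (h : ∀ i ∈ S, φ (v i) ≠ 0) :
    ff v S φ = S.card - 2 * (np v S φ : ℤ) := by
  unfold ff np
  rw [Finset.card_filter, Finset.card_eq_sum_ones]
  push_cast
  rw [Finset.mul_sum, ← Finset.sum_sub_distrib]
  refine Finset.sum_congr rfl fun i hi => ?_
  rcases lt_or_gt_of_ne (h i hi) with h' | h'
  · rw [sg_neg h', if_pos h'.le]; norm_num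
  · rw [sg_pos h', if_neg (not_le.2 h')]; norm_num

lemma ff_le_D [Nontrivial E] (v : ι → E) (S : Finset ι) (hA : AF v S) (φ : E →ₗ[ℝ] ℝ) :
    ff v S φ ≤ S.card - 2 * (kap v S : ℤ) := by
  obtain ⟨η, -, hη⟩ := exists_generic v (⊥ : Submodule ℝ E)
  have key : ∀ η : E →ₗ[ℝ] ℝ, (∀ i, v i ∉ (⊥ : Submodule ℝ E) → η (v i) ≠ 0) →
      ff v S φ + ff v (S.filter fun i => φ (v i) = 0) η ≤ S.card - 2 * (kap v S : ℤ) := by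
    intro η hη
    obtain ⟨χ, c1, c2, -⟩ := perturb v φ η
    rw [← ff_of_perturb v c1 c2 S, ff_generic v S χ]
    · have := kap_le v S χ
      omega
    · intro i hi h0
      by_cases h : φ (v i) = 0
      · have := c2 i h
        rw [h0, sg_zero] at this
        rcases lt_or_gt_of_ne (hη i (by simpa using hA.ne_zero hi)) with h' | h'
        · rw [sg_neg h'] at this; omega
        · rw [sg_pos h'] at this; omega
      · have := c1 i h
        rw [h0, sg_zero] at this
        rcases lt_or_gt_of_ne h with h' | h'
        · rw [sg_neg h'] at this; omega
        · rw [sg_pos h'] at this; omega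
  have k1 := key η hη
  have k2 := key (-η) (fun i hi => by simpa using hη i hi)
  rw [ff_neg] at k2
  omega

lemma ff_attained [Nontrivial E] (v : ι → E) (S : Finset ι) (hA : AF v S) :
    ∃ φ, ff v S φ = S.card - 2 * (kap v S : ℤ) := by
  obtain ⟨φ, h, hφ⟩ := kap_generic v S
  exact ⟨φ, by rw [ff_generic v S φ fun i hi => h i (hA.ne_zero hi), hφ]⟩

lemma one_le_D [Nontrivial E] (v : ι → E) (S : Finset ι) (hA : AF v S) (hS : S.Nonempty) :
    1 ≤ S.card - 2 * (kap v S : ℤ) := by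
  obtain ⟨p, hp⟩ := hS
  exact (line_card_pos v hp).trans (line_card_le v S hA _ (ff_le_D v S hA) hp)

lemma good_AF [Nontrivial E] [FiniteDimensional ℝ E] (v : ι → E) (S : Finset ι) (hA : AF v S)
    (hr : rk v S ≤ 4) : Good v S := by
  rcases Nat.eq_zero_or_pos (kap v S) with h0 | hpos
  · refine ⟨∅, by simp, by simp, by simpa using h0, ?_⟩
    have := rk_le_card v S
    rw [h0]
    simp only [Finset.card_empty]
    omega
  have hne : S.Nonempty := by
    rw [Finset.nonempty_iff_ne_empty]
    rintro rfl
    rw [kap_empty] at hpos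
    omega
  have hD1 := one_le_D v S hA hne
  have hD := ff_le_D v S hA
  by_cases hcase : (rk v S : ℤ) - (S.card - 2 * (kap v S : ℤ)) ≤ 1
  · refine ⟨{S}, ?_, ?_, by simp, ?_⟩
    · intro A hA B hB hne
      rw [Finset.mem_singleton] at hA hB
      exact absurd (hA.trans hB.symm) hne
    · intro T hT
      rw [Finset.mem_singleton] at hT
      subst hT
      exact ⟨subset_refl _, hpos⟩
    · rw [Finset.card_singleton]
      push_cast
      omega
  have hD2 : (S.card - 2 * (kap v S : ℤ)) ≠ 1 := by
    intro h
    have := sylvester_gallai v S hA (fun φ => (hD φ).trans h.le)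
    change rk v S ≤ 2 at this
    omega
  have hDeq : (S.card - 2 * (kap v S : ℤ)) = 2 := by omega
  have hr4 : 4 ≤ rk v S := by omega
  obtain ⟨P, Q, hcov, hdis, oP, oQ, cP, cQ⟩ :=
    rank_four v S hA (fun φ => (hD φ).trans hDeq.le) hr4
  have hsub : ∀ F : Submodule ℝ E, inF v S F ⊆ S := fun F i hi => (mem_inF.1 hi).1
  have hF : ∀ F : Submodule ℝ E, Odd (inF v S F).card → 2 ≤ (inF v S F).card →
      (inF v S F).card = 2 * kap v (inF v S F) + 1 ∧ 1 ≤ kap v (inF v S F) := by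
    intro F ho hc
    have hAF := hA.mono (hsub F)
    obtain ⟨φ, hφ⟩ := ff_attained v _ hAF
    have h2 := ff_restrict_le v S F 2 (fun φ => (hD φ).trans hDeq.le) φ
    have h1 := one_le_D v _ hAF (Finset.card_pos.1 (by omega))
    obtain ⟨k, hk⟩ := ho
    omega
  obtain ⟨eP, kP⟩ := hF P oP cP
  obtain ⟨eQ, kQ⟩ := hF Q oQ cQ
  have hd : Disjoint (inF v S P) (inF v S Q) := by
    rw [Finset.disjoint_left]
    intro i h1 h2
    exact hdis i (mem_inF.1 h1).1 ⟨(mem_inF.1 h1).2, (mem_inF.1 h2).2⟩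
  have hun : inF v S P ∪ inF v S Q = S := by
    ext i
    simp only [Finset.mem_union, mem_inF]
    constructor
    · rintro (h | h) <;> exact h.1
    · intro h
      exact (hcov i h).imp (fun h' => ⟨h, h'⟩) (fun h' => ⟨h, h'⟩)
  have hcard := Finset.card_union_of_disjoint hd
  rw [hun] at hcard
  have hPQ : inF v S P ≠ inF v S Q := by
    intro h
    rw [h] at hd
    have := disjoint_self.1 hd
    rw [this] at cQ
    simp at cQ
  refine ⟨{inF v S P, inF v S Q}, ?_, ?_, ?_, ?_⟩
  · intro A hA B hB hne
    rw [Finset.mem_insert, Finset.mem_singleton] at hA hB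
    rcases hA with rfl | rfl <;> rcases hB with rfl | rfl
    · exact absurd rfl hne
    · exact hd
    · exact hd.symm
    · exact absurd rfl hne
  · intro T hT
    rw [Finset.mem_insert, Finset.mem_singleton] at hT
    rcases hT with rfl | rfl
    · exact ⟨hsub _, kP⟩
    · exact ⟨hsub _, kQ⟩
  · rw [Finset.sum_pair hPQ]
    omega
  · rw [Finset.card_pair hPQ]
    push_cast
    omega

lemma good_all [Nontrivial E] [FiniteDimensional ℝ E] (v : ι → E) :
    ∀ (k : ℕ) (S : Finset ι), S.card = k → rk v S ≤ 4 → Good v S := by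
  intro k
  induction k using Nat.strong_induction_on with
  | _ k ih =>
  intro S hk hr
  by_cases hA : AF v S
  · exact good_AF v S hA hr
  rcases not_AF v S hA with ⟨i, hi, h0⟩ | ⟨i, hi, j, hj, hij, hvi, c, hc, hvj⟩
  · have hB : ({i} : Finset ι) ⊆ S := Finset.singleton_subset_iff.2 hi
    have hcd := Finset.card_sdiff_add_card_eq_card hB
    rw [Finset.card_singleton] at hcd
    have hnp : ∀ φ : E →ₗ[ℝ] ℝ, np v {i} φ = 1 := by
      intro φ
      simp [np, Finset.filter_singleton, h0]
    refine good_step v hB (fun φ => (hnp φ).ge) (fun φ _ => hnp φ) ?_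
      (ih _ (by omega) _ rfl ((rk_mono v Finset.sdiff_subset).trans hr))
    rw [Finset.card_singleton]
    refine Nat.add_le_add_right (Submodule.finrank_mono ?_) 1
    rw [Submodule.span_le]
    rintro _ ⟨s, hs, rfl⟩
    by_cases h : s = i
    · subst h
      rw [h0]
      exact Submodule.zero_mem _
    · exact Submodule.subset_span ⟨s, by simpa using ⟨hs, h⟩, rfl⟩
  · have hB : ({i, j} : Finset ι) ⊆ S := by
      intro s hs
      rw [Finset.mem_insert, Finset.mem_singleton] at hs
      rcases hs with rfl | rfl
      · exact hi
      · exact hj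
    have hcd := Finset.card_sdiff_add_card_eq_card hB
    rw [Finset.card_pair hij] at hcd
    have hnp : ∀ φ : E →ₗ[ℝ] ℝ, np v {i, j} φ =
        (if φ (v i) ≤ 0 then 1 else 0) + (if c * φ (v i) ≤ 0 then 1 else 0) := by
      intro φ
      unfold np
      rw [Finset.card_filter, Finset.sum_pair hij, hvj, map_smul, smul_eq_mul]
    refine good_step v hB (fun φ => ?_) (fun φ hφ => ?_) ?_
      (ih _ (by omega) _ rfl ((rk_mono v Finset.sdiff_subset).trans hr))
    · rw [hnp]
      by_cases h : φ (v i) ≤ 0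
      · rw [if_pos h]; omega
      · have : c * φ (v i) ≤ 0 := (mul_neg_of_neg_of_pos hc (not_le.1 h)).le
        rw [if_pos this]; omega
    · rw [hnp]
      rcases lt_or_gt_of_ne (hφ i hvi) with h | h
      · rw [if_pos h.le, if_neg (not_le.2 (mul_pos_of_neg_of_neg hc h))]
      · rw [if_neg (not_le.2 h), if_pos (mul_neg_of_neg_of_pos hc h).le]
    · rw [Finset.card_pair hij]
      have hle : Submodule.span ℝ (v '' (S : Set ι)) ≤
          Submodule.span ℝ (v '' ((S \ {i, j} : Finset ι) : Set ι)) ⊔ Submodule.span ℝ {v i} := by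
        rw [Submodule.span_le]
        rintro _ ⟨s, hs, rfl⟩
        by_cases h : s = i
        · subst h
          exact Submodule.mem_sup_right (Submodule.mem_span_singleton_self _)
        · by_cases h' : s = j
          · subst h'
            rw [hvj]
            exact Submodule.mem_sup_right
              (Submodule.smul_mem _ _ (Submodule.mem_span_singleton_self _))
          · exact Submodule.mem_sup_left (Submodule.subset_span
              ⟨s, by simpa using ⟨hs, h, h'⟩, rfl⟩)
      have h1 := Submodule.finrank_mono hle
      have h2 := Submodule.finrank_add_le_finrank_add_finrank
        (Submodule.span ℝ (v '' ((S \ {i, j} : Finset ι) : Set ι))) (Submodule.span ℝ {v i})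
      have h3 := finrank_span_singleton (K := ℝ) hvi
      unfold rk
      omega

lemma nonpos_univ (v : ι → E) (φ : E →ₗ[ℝ] ℝ) : nonposCount φ v = np v Finset.univ φ := rfl

lemma codeg_univ [Nontrivial E] (v : ι → E) : codegStar v = kap v Finset.univ := by
  rw [kap_eq]
  unfold codegStar
  rw [if_pos (inferInstance : Nontrivial E)]
  rfl

lemma pos_univ (v : ι → E) (φ : E →ₗ[ℝ] ℝ) :
    posCount φ v + np v Finset.univ φ = Fintype.card ι := by
  unfold posCount np
  have := Finset.card_filter_add_card_filter_not (s := (Finset.univ : Finset ι))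
    (fun i => 0 < φ (v i))
  simpa only [not_lt, Finset.card_univ] using this

lemma rk_univ (v : ι → E) : confRank v = rk v Finset.univ := by
  unfold confRank rk
  rw [Finset.coe_univ, Set.image_univ]

lemma deg_univ [Nontrivial E] (v : ι → E) :
    degStar v = (Fintype.card ι : ℤ) - kap v Finset.univ - confRank v := by
  have h : sSup {k | ∃ φ : E →ₗ[ℝ] ℝ, φ ≠ 0 ∧ posCount φ v = k} + kap v Finset.univ
      = Fintype.card ι := by
    obtain ⟨φ, hφ, hk⟩ := kap_exists v Finset.univ
    have hg : IsGreatest {k | ∃ φ : E →ₗ[ℝ] ℝ, φ ≠ 0 ∧ posCount φ v = k} (posCount φ v) := by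
      refine ⟨⟨φ, hφ, rfl⟩, ?_⟩
      rintro _ ⟨ψ, -, rfl⟩
      have h1 := pos_univ v φ
      have h2 := pos_univ v ψ
      have h3 := kap_le v Finset.univ ψ
      omega
    rw [hg.csSup_eq, ← hk]
    exact pos_univ v φ
  unfold degStar
  omega
/-- a configuration with `n` elements, rank `r ≤ 4` and dual degree `δ`
admits a codegree* decomposition of length `m ≥ d + 1 − 2δ` where `d = n − r − 1`
(as integers). -/
theorem codegree_decomposition_of_rank_le_four {E : Type*} [AddCommGroup E] [Module ℝ E]
    [FiniteDimensional ℝ E] (hE : 1 ≤ Module.finrank ℝ E)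
    {n : ℕ} (V : Fin n → E) (hr : confRank V ≤ 4) :
    ∃ (m : ℕ) (S : Fin (m + 1) → Finset (Fin n)),
      IsCodegDecomp V m S ∧
      ((n : ℤ) - (confRank V : ℤ) - 1) + 1 - 2 * degStar V ≤ (m : ℤ) := by
  have : Nontrivial E := Module.nontrivial_of_finrank_pos (R := ℝ) (by omega)
  obtain ⟨𝒯, t1, t2, t3, t4⟩ := good_all V _ Finset.univ rfl (by rw [← rk_univ]; exact hr)
  let e := 𝒯.equivFin.symm
  have hz : ∀ (j : Fin 𝒯.card),
      (Fin.cons (Finset.univ \ 𝒯.biUnion id) (fun j => (e j).1) :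
        Fin (𝒯.card + 1) → Finset (Fin n)) j.succ = (e j).1 := fun j => Fin.cons_succ _ _ _
  have hd0 : ∀ j, Disjoint (Finset.univ \ 𝒯.biUnion id) (e j).1 := by
    intro j
    rw [Finset.disjoint_left]
    intro x hx hx'
    exact (Finset.mem_sdiff.1 hx).2 (Finset.mem_biUnion.2 ⟨_, (e j).2, hx'⟩)
  refine ⟨𝒯.card, Fin.cons (Finset.univ \ 𝒯.biUnion id) (fun j => (e j).1),
    ⟨?_, ?_, ?_, ?_⟩, ?_⟩
  · intro i j
    refine Fin.cases ?_ (fun i => ?_) i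
    · refine Fin.cases (fun h => absurd rfl h) (fun j _ => ?_) j
      exact hd0 j
    · refine Fin.cases (fun _ => ?_) (fun j hij => ?_) j
      · exact (hd0 i).symm
      · refine t1 _ (e i).2 _ (e j).2 fun h => hij ?_
        rw [e.injective (Subtype.ext h)]
  · intro x
    by_cases hx : x ∈ 𝒯.biUnion id
    · obtain ⟨T, hT, hxT⟩ := Finset.mem_biUnion.1 hx
      refine ⟨(e.symm ⟨T, hT⟩).succ, ?_⟩
      rw [hz, Equiv.apply_symm_apply]
      exact hxT
    · exact ⟨0, by simpa using hx⟩
  · intro i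
    refine Fin.cases (fun h => absurd rfl h) (fun j _ => ?_) i
    exact (t2 _ (e j).2).2
  · have hs : ∀ f : Fin (𝒯.card + 1) → ℕ,
        ∑ i ∈ Finset.univ.erase 0, f i = ∑ j : Fin 𝒯.card, f j.succ := by
      intro f
      have h1 := Finset.add_sum_erase Finset.univ f (Finset.mem_univ 0)
      rw [Fin.sum_univ_succ] at h1
      omega
    rw [hs, codeg_univ, t3, ← Finset.sum_coe_sort]
    exact (Equiv.sum_comp e (fun T => kap V T.1)).symm
  · rw [deg_univ, rk_univ, Fintype.card_fin]
    rw [Finset.card_univ, Fintype.card_fin] at t4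
    omega

end
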